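/- The metric space (𝒢₀, d) of unlabeled countable weighted graphs of finite norm is complete: every Cauchy sequence in 𝒢₀ converges to an element of 𝒢₀. -/

import Mathlib

open scoped ENNReal
open Filter Topology

/-- Edges: 2-element subsets of the vertex set `ℕ`. -/
abbrev Edge : Type := {e : Sym2 ℕ // ¬ e.IsDiag}

/-- A labeled graph: an assignment of a real weight to each edge. -/
abbrev LGraph : Type := Edge → ℝ

/-- The norm of a labeled graph: the sum of the absolute values of its edge weights. -/
noncomputable def gnorm (w : LGraph) : ℝ≥0∞ := ∑' e : Edge, ENNReal.ofReal |w e|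

/-- A labeled graph has finite norm if its norm is finite. -/
def FiniteNorm (w : LGraph) : Prop := gnorm w ≠ ⊤

/-- The distance between two labeled graphs: `d(w,w') = |w - w'|`. -/
noncomputable def ldist (w w' : LGraph) : ℝ≥0∞ := ∑' e : Edge, ENNReal.ofReal |w e - w' e|

/-- A vertex is isolated if every edge containing it has weight `0`. -/
def Isolated (w : LGraph) (v : ℕ) : Prop := ∀ e : Edge, v ∈ e.val → w e = 0

/-- A labeled graph is standard if it has infinitely many isolated vertices. -/
def Standard (w : LGraph) : Prop := {v : ℕ | Isolated w v}.Infinite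

/-- The image of an edge under a bijection of the vertex set. -/
def mapEdge (f : ℕ ≃ ℕ) (e : Edge) : Edge :=
  ⟨e.val.map f, fun h => e.prop ((Sym2.isDiag_map f.injective).mp h)⟩

/-- Two labeled graphs are isomorphic if some bijection of the vertices carries the
weights of one to the other: `w(uv) = w'(f(u)f(v))` for all edges `uv`. -/
def GIso (w w' : LGraph) : Prop := ∃ f : ℕ ≃ ℕ, ∀ e : Edge, w e = w' (mapEdge f e)

/-- The isomorphism class of a labeled graph (as a set of labeled graphs). -/
def cls (w : LGraph) : Set LGraph := {w' | GIso w w'}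

/-- The distance between the isomorphism classes of two labeled graphs:
`d(G,G') = inf { d(u,v) : u ∈ G, v ∈ G' }`. -/
noncomputable def Gdist (w₁ w₂ : LGraph) : ℝ≥0∞ := ⨅ u ∈ cls w₁, ⨅ v ∈ cls w₂, ldist u v

theorem GIso.refl (w : LGraph) : GIso w w :=
  ⟨Equiv.refl ℕ, fun e => congrArg w (Subtype.ext (by simp [mapEdge]))⟩

theorem mapEdge_trans (f g : ℕ ≃ ℕ) (e : Edge) :
    mapEdge (f.trans g) e = mapEdge g (mapEdge f e) :=
  Subtype.ext (by simp [mapEdge, Sym2.map_map])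

theorem mapEdge_symm_mapEdge (f : ℕ ≃ ℕ) (e : Edge) : mapEdge f.symm (mapEdge f e) = e := by
  rw [← mapEdge_trans]
  exact Subtype.ext (by simp [mapEdge])

theorem mapEdge_mapEdge_symm (f : ℕ ≃ ℕ) (e : Edge) : mapEdge f (mapEdge f.symm e) = e :=
  mapEdge_symm_mapEdge f.symm e

/-- The permutation of the edges induced by a permutation of the vertices. -/
def edgePerm (f : ℕ ≃ ℕ) : Edge ≃ Edge where
  toFun := mapEdge f
  invFun := mapEdge f.symm
  left_inv := mapEdge_symm_mapEdge f
  right_inv := mapEdge_mapEdge_symm f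

theorem GIso.symm {w w' : LGraph} (h : GIso w w') : GIso w' w := by
  obtain ⟨f, hf⟩ := h
  exact ⟨f.symm, fun e => by rw [hf, mapEdge_mapEdge_symm]⟩

theorem GIso.trans {w w' w'' : LGraph} (h : GIso w w') (h' : GIso w' w'') : GIso w w'' := by
  obtain ⟨f, hf⟩ := h
  obtain ⟨f', hf'⟩ := h'
  exact ⟨f.trans f', fun e => by rw [hf, hf', mapEdge_trans]⟩

theorem Isolated.map {w w' : LGraph} {f : ℕ ≃ ℕ} (hf : ∀ e, w e = w' (mapEdge f e)) {v : ℕ} :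
    Isolated w v → Isolated w' (f v) := by
  intro hv e he
  rw [← mapEdge_mapEdge_symm f e, ← hf]
  exact hv _ (Sym2.mem_map.mpr ⟨f v, he, f.symm_apply_apply v⟩)

theorem GIso.standard {w w' : LGraph} (h : GIso w w') (hw : Standard w) : Standard w' := by
  obtain ⟨f, hf⟩ := h
  refine (hw.image f.injective.injOn).mono ?_
  rintro _ ⟨v, hv, rfl⟩
  exact Isolated.map hf hv

theorem GIso.gnorm_eq {w w' : LGraph} (h : GIso w w') : gnorm w = gnorm w' := by
  obtain ⟨f, hf⟩ := h
  simp only [gnorm, hf]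
  exact (edgePerm f).tsum_eq fun e => ENNReal.ofReal |w' e|

theorem ldist_eq_tsum_edist (w w' : LGraph) : ldist w w' = ∑' e, edist (w e) (w' e) := by
  simp only [ldist, edist_dist, Real.dist_eq]

theorem ldist_zero_right (w : LGraph) : ldist w 0 = gnorm w := by
  simp [ldist, gnorm]

theorem ldist_comm (w w' : LGraph) : ldist w w' = ldist w' w := by
  simp only [ldist_eq_tsum_edist, edist_comm]

theorem ldist_triangle (a b c : LGraph) : ldist a c ≤ ldist a b + ldist b c := by
  simp only [ldist_eq_tsum_edist, ← ENNReal.tsum_add]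
  exact ENNReal.tsum_le_tsum fun e => edist_triangle _ _ _

theorem ldist_comp_mapEdge (f : ℕ ≃ ℕ) (w w' : LGraph) :
    ldist (w ∘ mapEdge f) (w' ∘ mapEdge f) = ldist w w' :=
  (edgePerm f).tsum_eq fun e => ENNReal.ofReal |w e - w' e|

theorem GIso.exists_ldist_lt {w₁ w₂ h : LGraph} {ε : ℝ≥0∞} (hd : Gdist w₁ w₂ < ε)
    (hh : GIso w₁ h) : ∃ v, GIso w₂ v ∧ ldist h v < ε := by
  simp only [Gdist, iInf_lt_iff] at hd
  obtain ⟨a, ha, b, hb, hab⟩ := hd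
  obtain ⟨f, hf⟩ := hh.symm.trans ha
  obtain rfl : h = a ∘ mapEdge f := funext hf
  exact ⟨b ∘ mapEdge f, GIso.trans hb (GIso.symm ⟨f, fun _ => rfl⟩),
    by rwa [ldist_comp_mapEdge]⟩

/-- The edge map induced by an injection of the vertex set. -/
def embEdge (φ : ℕ ↪ ℕ) (e : Edge) : Edge :=
  ⟨e.val.map φ, fun h => e.prop ((Sym2.isDiag_map φ.injective).mp h)⟩

theorem embEdge_injective (φ : ℕ ↪ ℕ) : Function.Injective (embEdge φ) := fun _ _ h =>
  Subtype.ext (Sym2.map.injective φ.injective (congrArg Subtype.val h))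

/-- The copy of a labeled graph on the range of an injection of the vertex set. -/
noncomputable def push (φ : ℕ ↪ ℕ) (w : LGraph) : LGraph := Function.extend (embEdge φ) w (0 : Edge → ℝ)

theorem push_embEdge (φ : ℕ ↪ ℕ) (w : LGraph) (e : Edge) : push φ w (embEdge φ e) = w e :=
  (embEdge_injective φ).extend_apply w 0 e

theorem push_of_notMem_range {φ : ℕ ↪ ℕ} (w : LGraph) {e : Edge}
    (he : e ∉ Set.range (embEdge φ)) : push φ w e = 0 :=
  Function.extend_apply' w (0 : Edge → ℝ) e he

theorem ldist_push (φ : ℕ ↪ ℕ) (w w' : LGraph) : ldist (push φ w) (push φ w') = ldist w w' := by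
  simp only [ldist]
  rw [← (embEdge_injective φ).tsum_eq]
  · simp only [push_embEdge]
  · intro e he
    by_contra hr
    simp [push_of_notMem_range _ hr] at he

theorem standard_push {φ : ℕ ↪ ℕ} (hφ : (Set.range φ)ᶜ.Infinite) (w : LGraph) :
    Standard (push φ w) := by
  refine hφ.mono fun v hv e he => push_of_notMem_range w ?_
  rintro ⟨e', rfl⟩
  obtain ⟨x, -, hx⟩ := Sym2.mem_map.mp he
  exact hv ⟨x, hx⟩

theorem exists_perm_eqOn (φ : ℕ ↪ ℕ) {S : Set ℕ} (hS : Sᶜ.Infinite) :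
    ∃ f : ℕ ≃ ℕ, Set.EqOn f φ S := by
  classical
  have h' : (φ '' S)ᶜ.Infinite := by
    refine (hS.image φ.injective.injOn).mono ?_
    rintro _ ⟨x, hx, rfl⟩ ⟨y, hy, hyx⟩
    exact hx (φ.injective hyx ▸ hy)
  have := hS.to_subtype
  have := h'.to_subtype
  obtain ⟨c⟩ : Nonempty ((Sᶜ : Set ℕ) ≃ ((φ '' S)ᶜ : Set ℕ)) := nonempty_equiv_of_countable
  refine ⟨(Equiv.Set.sumCompl S).symm.trans
    (((Equiv.Set.image φ S φ.injective).sumCongr c).trans (Equiv.Set.sumCompl (φ '' S))), ?_⟩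
  intro x hx
  simp [Equiv.Set.sumCompl_symm_apply_of_mem hx]

theorem gIso_push (φ : ℕ ↪ ℕ) {w : LGraph} (hw : Standard w) : GIso w (push φ w) := by
  obtain ⟨f, hf⟩ := exists_perm_eqOn φ (S := {v | Isolated w v}ᶜ) (by rwa [compl_compl])
  refine ⟨f, fun e => ?_⟩
  by_cases hE : ∃ v ∈ e.val, Isolated w v
  · obtain ⟨v, hve, hv⟩ := hE
    rw [hv e hve]
    by_cases hr : mapEdge f e ∈ Set.range (embEdge φ)
    · obtain ⟨e', he'⟩ := hr
      rw [← he', push_embEdge]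
      have hmem : f v ∈ (embEdge φ e').val := he' ▸ Sym2.mem_map.mpr ⟨v, hve, rfl⟩
      obtain ⟨x, hx, hxv⟩ := Sym2.mem_map.mp hmem
      by_cases hxi : Isolated w x
      · exact (hxi e' hx).symm
      · have : x = v := f.injective ((hf hxi).trans hxv)
        exact absurd (this ▸ hv) hxi
    · exact (push_of_notMem_range w hr).symm
  · push Not at hE
    have : mapEdge f e = embEdge φ e :=
      Subtype.ext (Sym2.map_congr fun v hv => hf (hE v hv))
    rw [this, push_embEdge]

theorem exists_ldist_le_tsum {h : ℕ → LGraph} {δ : ℕ → ℝ≥0∞} (hδ : ∑' k, δ k ≠ ⊤)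
    (hh : ∀ k, ldist (h k) (h (k + 1)) ≤ δ k) :
    ∃ l : LGraph, ∀ k, ldist (h k) l ≤ ∑' m, δ (m + k) := by
  have hlim : ∀ e, ∃ x, Tendsto (fun k => h k e) atTop (𝓝 x) := fun e =>
    cauchySeq_tendsto_of_complete <| cauchySeq_of_edist_le_of_tsum_ne_top δ
      (fun k => (ENNReal.le_tsum e).trans ((ldist_eq_tsum_edist _ _).symm.le.trans (hh k))) hδ
  choose l hl using hlim
  refine ⟨l, fun k => ?_⟩
  calc ldist (h k) l
      ≤ ∑' e, ∑' m, edist (h (k + m) e) (h (k + m + 1) e) := by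
        rw [ldist_eq_tsum_edist]
        exact ENNReal.tsum_le_tsum fun e =>
          edist_le_tsum_of_edist_le_of_tendsto (fun n => edist (h n e) (h (n + 1) e))
            (fun n => le_rfl) (hl e) k
    _ = ∑' m, ldist (h (k + m)) (h (k + m + 1)) := by
        rw [ENNReal.tsum_comm]
        simp only [ldist_eq_tsum_edist]
    _ ≤ ∑' m, δ (m + k) :=
        ENNReal.tsum_le_tsum fun m => add_comm m k ▸ hh (k + m)

/-- The metric space `𝒢₀` is complete: every Cauchy sequence converges. -/
theorem G0_complete (g : ℕ → LGraph)
    (hg : ∀ n, Standard (g n) ∧ FiniteNorm (g n))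
    (hC : ∀ eps : ℝ≥0∞, 0 < eps → ∃ N : ℕ, ∀ m, N ≤ m → ∀ n, N ≤ n →
      Gdist (g m) (g n) < eps) :
    ∃ u : LGraph, Standard u ∧ FiniteNorm u ∧
      Filter.Tendsto (fun n => Gdist (g n) u) Filter.atTop (𝓝 0) := by
  have hδ : ∑' k, (2⁻¹ : ℝ≥0∞) ^ k ≠ ⊤ := by simp [ENNReal.tsum_geometric]
  choose N hN using fun k : ℕ => hC (2⁻¹ ^ k) (ENNReal.pow_pos (by simp) k)
  let s : ℕ → ℕ := fun k => (Finset.range (k + 1)).sup N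
  have hs : ∀ {j k}, j ≤ k → N j ≤ s k := fun hjk =>
    Finset.le_sup (f := N) (Finset.mem_range.mpr (Nat.lt_succ_of_le hjk))
  have hstep : ∀ k (a : {a // GIso (g (s k)) a}), ∃ b : {b // GIso (g (s (k + 1))) b},
      ldist a.1 b.1 < 2⁻¹ ^ k := fun k a => by
    obtain ⟨b, hb, hab⟩ :=
      a.2.exists_ldist_lt (hN k _ (hs le_rfl) _ (hs (Nat.le_succ k)))
    exact ⟨⟨b, hb⟩, hab⟩
  choose next hnext using hstep
  let h : ∀ k, {a // GIso (g (s k)) a} := Nat.rec ⟨_, GIso.refl _⟩ next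
  obtain ⟨l, hl⟩ := exists_ldist_le_tsum (h := fun k => (h k).1) hδ fun k => (hnext k (h k)).le
  let φ : ℕ ↪ ℕ := ⟨fun n => 2 * n, fun a b hab => by simpa using hab⟩
  have hφ : (Set.range φ)ᶜ.Infinite := by
    refine Set.infinite_of_injective_forall_mem (f := fun n : ℕ => 2 * n + 1)
      (fun a b hab => by simpa using hab) ?_
    rintro n ⟨m, hm⟩
    have : 2 * m = 2 * n + 1 := hm
    omega
  have hiso : ∀ k, GIso (g (s k)) (push φ (h k).1) := fun k =>
    (h k).2.trans (gIso_push φ ((h k).2.standard (hg _).1))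
  refine ⟨push φ l, standard_push hφ l, ?_, ?_⟩
  · have hfin : gnorm (push φ (h 0).1) ≠ ⊤ := (hiso 0).gnorm_eq ▸ (hg _).2
    rw [FiniteNorm, ← ldist_zero_right]
    refine ne_top_of_le_ne_top (ENNReal.add_ne_top.mpr ⟨?_, ?_⟩)
      (ldist_triangle _ (push φ (h 0).1) _)
    · rw [ldist_push, ldist_comm]
      exact ne_top_of_le_ne_top hδ (hl 0)
    · rwa [ldist_zero_right]
  · rw [ENNReal.tendsto_atTop_zero]
    intro ε hε
    have htail := ENNReal.tendsto_sum_nat_add (fun k => (2⁻¹ : ℝ≥0∞) ^ k) hδ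
    obtain ⟨k, hk⟩ := (htail.eventually (gt_mem_nhds (ENNReal.half_pos hε.ne'))).exists
    refine ⟨N k, fun n hn => ?_⟩
    obtain ⟨v, hv, hvd⟩ := (hiso k).exists_ldist_lt (hN k _ (hs le_rfl) n hn)
    have hpow : (2⁻¹ : ℝ≥0∞) ^ k ≤ ∑' m, 2⁻¹ ^ (m + k) := by
      simpa using ENNReal.le_tsum (f := fun m => (2⁻¹ : ℝ≥0∞) ^ (m + k)) 0
    calc Gdist (g n) (push φ l)
        ≤ ldist v (push φ l) := iInf₂_le_of_le v hv (iInf₂_le _ (GIso.refl _))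
      _ ≤ ldist v (push φ (h k).1) + ldist (push φ (h k).1) (push φ l) := ldist_triangle _ _ _
      _ ≤ ε / 2 + ε / 2 := by
        rw [ldist_comm v, ldist_push]
        exact add_le_add (hvd.le.trans (hpow.trans hk.le)) ((hl k).trans hk.le)
      _ = ε := ENNReal.add_halves ε
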